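/- Let S be a finite set of real numbers (points on a line) with |S| ≥ 3. Let p ∈ S attain the minimum, i.e. cost₂(p,S) = cost₂(S), and let a, b ∈ S∖{p} be its first and second closest points: a ≠ b, |p−a| ≤ |p−b|, |p−q| ≥ |p−b| for every q ∈ S∖{p,a,b}, and cost₂(S) = |p−a| + |p−b|. Then (i) a and b lie on opposite sides of p on the line, i.e. it is not the case that both a < p and b < p, nor that both a > p and b > p; and (ii) no point of S∖{a,p,b} lies strictly between min(a,b) and max(a,b); in particular a, p, b are consecutive points of S on the line. -/

import Mathlib

open scoped Classical

/-- `cost₂(p, S)` for points on the real line: the minimum over pairs of distinct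
points `q, q' ∈ S \ {p}` of `|p − q| + |p − q'|`. -/
noncomputable def cost2At (p : ℝ) (S : Finset ℝ) : ℝ :=
  sInf {x : ℝ | ∃ q ∈ S.erase p, ∃ q' ∈ S.erase p, q ≠ q' ∧ x = |p - q| + |p - q'|}

/-- `cost₂(S) = min_{p ∈ S} cost₂(p, S)` for points on the real line. -/
noncomputable def cost2 (S : Finset ℝ) : ℝ :=
  sInf {x : ℝ | ∃ p ∈ S, x = cost2At p S}

/-- on a line, a solution point and its two supporting points are
consecutive, with the supporting points on opposite sides of the solution point. -/
theorem line_supporting_points_consecutive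
    (S : Finset ℝ) (hS : 3 ≤ S.card)
    (p a b : ℝ) (hp : p ∈ S) (ha : a ∈ S) (hb : b ∈ S)
    (hap : a ≠ p) (hbp : b ≠ p) (hab : a ≠ b)
    (hmin : cost2At p S = cost2 S)
    (horder : |p - a| ≤ |p - b|)
    (hsecond : ∀ q ∈ S, q ≠ p → q ≠ a → q ≠ b → |p - b| ≤ |p - q|)
    (hcost : cost2 S = |p - a| + |p - b|) :
    (¬ (a < p ∧ b < p) ∧ ¬ (p < a ∧ p < b)) ∧
      ∀ q ∈ S, q ≠ a → q ≠ p → q ≠ b → ¬ (min a b < q ∧ q < max a b) := by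
  have key : ∀ r ∈ S, ∀ q ∈ S, ∀ q' ∈ S, q ≠ r → q' ≠ r → q ≠ q' →
      cost2 S ≤ |r - q| + |r - q'| := by
    intro r hr q hq q' hq' h1 h2 h3
    have hA : cost2 S ≤ cost2At r S := by
      refine csInf_le ⟨0, ?_⟩ ⟨r, hr, rfl⟩
      rintro x ⟨t, _, rfl⟩
      refine Real.sInf_nonneg ?_
      rintro x ⟨u, _, v, _, _, rfl⟩
      positivity
    refine hA.trans (csInf_le ⟨0, ?_⟩
      ⟨q, Finset.mem_erase.2 ⟨h1, hq⟩, q', Finset.mem_erase.2 ⟨h2, hq'⟩, h3, rfl⟩)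
    rintro x ⟨u, _, v, _, _, rfl⟩
    positivity
  have k := key a ha p hp b hb hap.symm hab.symm hbp.symm
  rw [hcost] at k
  have h1 : ¬ (a < p ∧ b < p) := by
    rintro ⟨h, h'⟩
    rw [abs_of_pos (sub_pos.2 h), abs_of_pos (sub_pos.2 h')] at horder k
    rw [abs_of_neg (sub_neg.2 h), abs_of_nonneg (by linarith : 0 ≤ a - b)] at k
    linarith
  have h2 : ¬ (p < a ∧ p < b) := by
    rintro ⟨h, h'⟩
    rw [abs_of_neg (sub_neg.2 h), abs_of_neg (sub_neg.2 h')] at horder k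
    rw [abs_of_pos (sub_pos.2 h), abs_of_nonpos (by linarith : a - b ≤ 0)] at k
    linarith
  refine ⟨⟨h1, h2⟩, ?_⟩
  rintro q hq hqa hqp hqb ⟨hl, hu⟩
  have hs := hsecond q hq hqp hqa hqb
  clear key k hsecond hmin hcost
  rcases lt_or_gt_of_ne hap with h | h <;> rcases lt_or_gt_of_ne hbp with h' | h'
  · exact h1 ⟨h, h'⟩
  · rw [min_eq_left (by linarith)] at hl
    rw [max_eq_right (by linarith)] at hu
    rw [abs_of_pos (sub_pos.2 h), abs_of_neg (sub_neg.2 h')] at horder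
    rw [abs_of_neg (sub_neg.2 h')] at hs
    rcases abs_cases (p - q) with ⟨e, _⟩ | ⟨e, _⟩ <;> linarith
  · rw [min_eq_right (by linarith)] at hl
    rw [max_eq_left (by linarith)] at hu
    rw [abs_of_neg (sub_neg.2 h), abs_of_pos (sub_pos.2 h')] at horder
    rw [abs_of_pos (sub_pos.2 h')] at hs
    rcases abs_cases (p - q) with ⟨e, _⟩ | ⟨e, _⟩ <;> linarith
  · exact h2 ⟨h, h'⟩
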